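/- With A ⊂ ℤ^{n+1} finite, all of first coordinate 1, P_a > 0, and K(α) = ∫_{ℝ₊ⁿ} t^{α̃}/(Σ_{a∈A} P_a t^{ã})^{α₀} dt₁/t₁⋯dt_n/t_n defined for Re(α) in the interior of the cone generated by A, for every w ∈ ℤ^{n+1} one has ⟨w, α⟩ K(α) = α₀ Σ_{a∈A} ⟨w, a⟩ P_a K(α + a). -/

import Mathlib

open MeasureTheory

/-- The integrand `t^{α̃} / ((Σ_{a∈A} P_a t^{ã})^{α₀} · t₁⋯t_n)` (the factor
`1/(t₁⋯t_n)` accounts for the measure `dt₁/t₁ ⋯ dt_n/t_n`). -/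
noncomputable def toricIntegrand (n : ℕ) (A : Finset (Fin n → ℤ))
    (P : (Fin n → ℤ) → ℝ) (α0 : ℂ) (α : Fin n → ℂ) (t : Fin n → ℝ) : ℂ :=
  (∏ i, (t i : ℂ) ^ (α i)) /
    ((((∑ a ∈ A, P a * ∏ i, t i ^ (a i)) : ℝ) : ℂ) ^ α0 * ∏ i, (t i : ℂ))

/-- The cone `C_A ⊆ ℝ^{n+1}` generated by the points `(1, ã)` for `ã ∈ A`. -/
def coneA (n : ℕ) (A : Finset (Fin n → ℤ)) : Set (ℝ × (Fin n → ℝ)) :=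
  {x | ∃ c : (Fin n → ℤ) → ℝ, (∀ a, 0 ≤ c a) ∧
    x = ∑ a ∈ A, c a • (((1 : ℝ), fun i => (a i : ℝ)) : ℝ × (Fin n → ℝ))}

/-- The (generalized Feynman) integral `K(α)` over the positive orthant. -/
noncomputable def Kint (n : ℕ) (A : Finset (Fin n → ℤ)) (P : (Fin n → ℤ) → ℝ)
    (α0 : ℂ) (α : Fin n → ℂ) : ℂ :=
  ∫ t in {t : Fin n → ℝ | ∀ i, 0 < t i}, toricIntegrand n A P α0 α t

/-- The polynomial `Σ_{a∈A} P_a t^{ã}` in the logarithmic coordinates `t = exp x`. -/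
noncomputable def expSum {n : ℕ} (A : Finset (Fin n → ℤ)) (P : (Fin n → ℤ) → ℝ)
    (x : Fin n → ℝ) : ℝ :=
  ∑ a ∈ A, P a * Real.exp (∑ i, (a i : ℝ) * x i)

/-- The integrand of `Kint` in the logarithmic coordinates `t = exp x`, with respect to `dx`. -/
noncomputable def logIntegrand {n : ℕ} (A : Finset (Fin n → ℤ)) (P : (Fin n → ℤ) → ℝ)
    (α0 : ℂ) (α : Fin n → ℂ) (x : Fin n → ℝ) : ℂ :=
  Complex.exp (∑ i, α i * (x i : ℂ) - α0 * (Real.log (expSum A P x) : ℂ))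

lemma expSum_pos {n : ℕ} {A : Finset (Fin n → ℤ)} {P : (Fin n → ℤ) → ℝ} (hA : A.Nonempty)
    (hP : ∀ a ∈ A, 0 < P a) (x : Fin n → ℝ) : 0 < expSum A P x :=
  Finset.sum_pos (fun a ha => mul_pos (hP a ha) (Real.exp_pos _)) hA

lemma continuous_expSum {n : ℕ} (A : Finset (Fin n → ℤ)) (P : (Fin n → ℤ) → ℝ) :
    Continuous (expSum A P) := by
  unfold expSum
  fun_prop

lemma continuous_logIntegrand {n : ℕ} {A : Finset (Fin n → ℤ)} {P : (Fin n → ℤ) → ℝ}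
    (hA : A.Nonempty) (hP : ∀ a ∈ A, 0 < P a) (α0 : ℂ) (α : Fin n → ℂ) :
    Continuous (logIntegrand A P α0 α) := by
  have := (continuous_expSum A P).log (fun x => (expSum_pos hA hP x).ne')
  unfold logIntegrand
  fun_prop

lemma integral_posOrthant_eq_integral_exp {n : ℕ} {E : Type*} [NormedAddCommGroup E]
    [NormedSpace ℝ E] (g : (Fin n → ℝ) → E) :
    ∫ t in {t : Fin n → ℝ | ∀ i, 0 < t i}, g t =
      ∫ x : Fin n → ℝ, (∏ i, Real.exp (x i)) • g (fun i => Real.exp (x i)) := by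
  have himage : {t : Fin n → ℝ | ∀ i, 0 < t i} =
      (fun (x : Fin n → ℝ) i => Real.exp (x i)) '' Set.univ := by
    ext t
    simp only [Set.mem_ofPred_eq, Set.image_univ, Set.mem_range]
    constructor
    · exact fun h => ⟨fun i => Real.log (t i), funext fun i => Real.exp_log (h i)⟩
    · rintro ⟨x, rfl⟩ i
      exact Real.exp_pos _
  have hderiv (x : Fin n → ℝ) : HasFDerivAt (fun (x : Fin n → ℝ) i => Real.exp (x i))
      (ContinuousLinearMap.pi fun i =>
        (Real.exp (x i) • ContinuousLinearMap.id ℝ ℝ).comp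
          (ContinuousLinearMap.proj (R := ℝ) (φ := fun _ : Fin n => ℝ) i)) x := by
    rw [hasFDerivAt_pi]
    intro i
    have h := (hasFDerivAt_apply (𝕜 := ℝ) (F' := fun _ : Fin n => ℝ) i x).exp
    simpa using h
  rw [himage, integral_image_eq_integral_abs_det_fderiv_smul volume MeasurableSet.univ
    (fun x _ => (hderiv x).hasFDerivWithinAt)
    (fun x _ y _ h => funext fun i => Real.exp_injective (congrFun h i)), setIntegral_univ]
  congr 1 with x
  rw [ContinuousLinearMap.det_pi]
  simp [ContinuousLinearMap.det, abs_of_pos (Finset.prod_pos fun i _ => Real.exp_pos (x i))]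

lemma smul_toricIntegrand_exp {n : ℕ} {A : Finset (Fin n → ℤ)} {P : (Fin n → ℤ) → ℝ}
    (hA : A.Nonempty) (hP : ∀ a ∈ A, 0 < P a) (α0 : ℂ) (α : Fin n → ℂ) (x : Fin n → ℝ) :
    (∏ i, Real.exp (x i)) • toricIntegrand n A P α0 α (fun i => Real.exp (x i)) =
      logIntegrand A P α0 α x := by
  have hsum : ∑ a ∈ A, P a * ∏ i, Real.exp (x i) ^ (a i) = expSum A P x := by
    unfold expSum
    refine Finset.sum_congr rfl fun a _ => ?_
    rw [Real.exp_sum]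
    simp only [mul_comm (a _ : ℝ), Real.exp_mul, Real.rpow_intCast]
  have hpow (i : Fin n) : ((Real.exp (x i) : ℝ) : ℂ) ^ (α i) = Complex.exp (α i * x i) := by
    rw [Complex.cpow_def_of_ne_zero (by simp), ← Complex.ofReal_log (Real.exp_pos _).le,
      Real.log_exp, mul_comm]
  have hG := expSum_pos hA hP x
  have hprod : (∏ i, ((Real.exp (x i) : ℝ) : ℂ)) ≠ 0 :=
    Finset.prod_ne_zero_iff.2 fun i _ => by simp
  unfold toricIntegrand logIntegrand
  rw [hsum, Complex.cpow_def_of_ne_zero (by exact_mod_cast hG.ne'),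
    ← Complex.ofReal_log hG.le, Complex.exp_sub, Complex.exp_sum, Complex.real_smul,
    Complex.ofReal_prod, mul_comm α0]
  simp only [hpow]
  field_simp

lemma Kint_eq_integral_logIntegrand {n : ℕ} {A : Finset (Fin n → ℤ)} {P : (Fin n → ℤ) → ℝ}
    (hA : A.Nonempty) (hP : ∀ a ∈ A, 0 < P a) (α0 : ℂ) (α : Fin n → ℂ) :
    Kint n A P α0 α = ∫ x, logIntegrand A P α0 α x := by
  rw [Kint, integral_posOrthant_eq_integral_exp]
  simp only [smul_toricIntegrand_exp hA hP]

lemma integrable_exp_neg_mul_abs {ε : ℝ} (hε : 0 < ε) :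
    Integrable fun x : ℝ => Real.exp (-ε * |x|) := by
  rw [← integrableOn_univ, ← Set.Iic_union_Ioi (a := (0 : ℝ)), integrableOn_union]
  constructor
  · refine (integrableOn_exp_mul_Iic hε 0).congr_fun (fun x hx => ?_) measurableSet_Iic
    simp [abs_of_nonpos (Set.mem_Iic.1 hx)]
  · refine (exp_neg_integrableOn_Ioi 0 hε).congr_fun (fun x hx => ?_) measurableSet_Ioi
    simp [abs_of_pos (Set.mem_Ioi.1 hx)]

lemma nonempty_of_mem_interior_coneA {n : ℕ} {A : Finset (Fin n → ℤ)} {r : ℝ × (Fin n → ℝ)}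
    (h : r ∈ interior (coneA n A)) : A.Nonempty := by
  rw [Finset.nonempty_iff_ne_empty]
  rintro rfl
  have : coneA n ∅ ⊆ {0} := by
    rintro x ⟨c, -, rfl⟩
    simp
  simpa using interior_mono this h

/-- Each point of the cone bounds the corresponding real exponential by a power of `expSum`, with a
constant depending only on the first coordinate of the point. -/
lemma sum_mul_le_of_mem_coneA {n : ℕ} {A : Finset (Fin n → ℤ)} {P : (Fin n → ℤ) → ℝ}
    (hP : ∀ a ∈ A, 0 < P a) {r0 : ℝ} {r : Fin n → ℝ} (h : (r0, r) ∈ coneA n A)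
    (x : Fin n → ℝ) :
    ∑ i, r i * x i ≤ r0 * Real.log (expSum A P x) + r0 * ∑ a ∈ A, |Real.log (P a)| := by
  obtain ⟨c, hc, hr⟩ := h
  have hr0 : r0 = ∑ a ∈ A, c a := by
    simpa [Prod.fst_sum] using congrArg Prod.fst hr
  have hri (i : Fin n) : r i = ∑ a ∈ A, c a * a i := by
    simpa [Prod.snd_sum] using congrFun (congrArg Prod.snd hr) i
  have hle (a) (ha : a ∈ A) : ∑ i, (a i : ℝ) * x i ≤
      Real.log (expSum A P x) + ∑ b ∈ A, |Real.log (P b)| := by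
    have h1 : P a * Real.exp (∑ i, (a i : ℝ) * x i) ≤ expSum A P x :=
      Finset.single_le_sum (f := fun a => P a * Real.exp (∑ i, (a i : ℝ) * x i))
        (fun b hb => mul_nonneg (hP b hb).le (Real.exp_pos _).le) ha
    have h2 := Real.log_le_log (mul_pos (hP a ha) (Real.exp_pos _)) h1
    rw [Real.log_mul (hP a ha).ne' (Real.exp_ne_zero _), Real.log_exp] at h2
    have h3 : |Real.log (P a)| ≤ ∑ b ∈ A, |Real.log (P b)| :=
      Finset.single_le_sum (f := fun b => |Real.log (P b)|) (fun b _ => abs_nonneg _) ha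
    linarith [neg_abs_le (Real.log (P a))]
  calc ∑ i, r i * x i = ∑ a ∈ A, c a * ∑ i, (a i : ℝ) * x i := by
        simp only [hri, Finset.sum_mul, Finset.mul_sum, mul_assoc]
        exact Finset.sum_comm
    _ ≤ ∑ a ∈ A, c a * (Real.log (expSum A P x) + ∑ b ∈ A, |Real.log (P b)|) :=
        Finset.sum_le_sum fun a ha => mul_le_mul_of_nonneg_left (hle a ha) (hc a)
    _ = _ := by rw [← Finset.sum_mul, ← hr0, mul_add]

lemma norm_logIntegrand {n : ℕ} (A : Finset (Fin n → ℤ)) (P : (Fin n → ℤ) → ℝ)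
    (α0 : ℂ) (α : Fin n → ℂ) (x : Fin n → ℝ) :
    ‖logIntegrand A P α0 α x‖ =
      Real.exp (∑ i, (α i).re * x i - α0.re * Real.log (expSum A P x)) := by
  simp [logIntegrand, Complex.norm_exp]

lemma integrable_logIntegrand {n : ℕ} {A : Finset (Fin n → ℤ)} {P : (Fin n → ℤ) → ℝ}
    (hP : ∀ a ∈ A, 0 < P a) {α0 : ℂ} {α : Fin n → ℂ}
    (hα : ((α0.re, fun i => (α i).re) : ℝ × (Fin n → ℝ)) ∈ interior (coneA n A)) :
    Integrable (logIntegrand A P α0 α) := by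
  have hA := nonempty_of_mem_interior_coneA hα
  obtain ⟨ε, hε, hball⟩ := Metric.nhds_basis_closedBall.mem_iff.1 (mem_interior_iff_mem_nhds.1 hα)
  have hdom := (Integrable.fintype_prod (ι := Fin n) (𝕜 := ℝ)
    (fun _ => integrable_exp_neg_mul_abs hε)).const_mul
      (Real.exp (α0.re * ∑ a ∈ A, |Real.log (P a)|))
  refine hdom.mono' (continuous_logIntegrand hA hP α0 α).aestronglyMeasurable
    (Filter.Eventually.of_forall fun x => ?_)
  have hmem : (α0.re, fun i => (α i).re + ε * SignType.sign (x i)) ∈ coneA n A := by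
    apply hball
    rw [Metric.mem_closedBall, Prod.dist_eq, dist_self, max_le_iff, dist_pi_le_iff hε.le]
    refine ⟨hε.le, fun i => ?_⟩
    rw [Real.dist_eq, add_sub_cancel_left, abs_mul, abs_of_pos hε]
    refine mul_le_of_le_one_right hε.le ?_
    rcases lt_trichotomy (x i) 0 with h | h | h <;> simp [h]
  have hsum := sum_mul_le_of_mem_coneA hP hmem x
  simp only [add_mul, mul_assoc, sign_mul_self, Finset.sum_add_distrib] at hsum
  rw [norm_logIntegrand, ← Real.exp_sum, ← Real.exp_add, Real.exp_le_exp]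
  simp only [neg_mul, Finset.sum_neg_distrib]
  linarith

lemma logIntegrand_add {n : ℕ} {A : Finset (Fin n → ℤ)} {P : (Fin n → ℤ) → ℝ}
    (hA : A.Nonempty) (hP : ∀ a ∈ A, 0 < P a) (α0 : ℂ) (α : Fin n → ℂ) (a : Fin n → ℤ)
    (x : Fin n → ℝ) :
    logIntegrand A P (α0 + 1) (fun i => α i + (a i : ℂ)) x =
      ((Real.exp (∑ i, (a i : ℝ) * x i) / expSum A P x : ℝ) : ℂ) * logIntegrand A P α0 α x := by
  have hG := expSum_pos hA hP x
  have hquot : Real.exp (∑ i, (a i : ℝ) * x i) / expSum A P x =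
      Real.exp (∑ i, (a i : ℝ) * x i - Real.log (expSum A P x)) := by
    rw [Real.exp_sub, Real.exp_log hG]
  rw [hquot, logIntegrand, logIntegrand, Complex.ofReal_exp, ← Complex.exp_add]
  congr 1
  push_cast
  simp only [add_mul, Finset.sum_add_distrib]
  ring

lemma integrable_logIntegrand_add {n : ℕ} {A : Finset (Fin n → ℤ)} {P : (Fin n → ℤ) → ℝ}
    (hP : ∀ a ∈ A, 0 < P a) {α0 : ℂ} {α : Fin n → ℂ}
    (hα : ((α0.re, fun i => (α i).re) : ℝ × (Fin n → ℝ)) ∈ interior (coneA n A))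
    {a : Fin n → ℤ} (ha : a ∈ A) :
    Integrable (logIntegrand A P (α0 + 1) (fun i => α i + (a i : ℂ))) := by
  have hA := nonempty_of_mem_interior_coneA hα
  have hG := expSum_pos hA hP
  have hcont : Continuous fun x : Fin n → ℝ =>
      ((Real.exp (∑ i, (a i : ℝ) * x i) / expSum A P x : ℝ) : ℂ) :=
    Complex.continuous_ofReal.comp
      (Continuous.div (by fun_prop) (continuous_expSum A P) fun x => (hG x).ne')
  simp only [funext (logIntegrand_add hA hP α0 α a)]
  refine (integrable_logIntegrand hP hα).bdd_mul (c := (P a)⁻¹) hcont.aestronglyMeasurable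
    (Filter.Eventually.of_forall fun x => ?_)
  rw [Complex.norm_real, Real.norm_of_nonneg (div_nonneg (Real.exp_pos _).le (hG x).le),
    div_le_iff₀ (hG x), inv_mul_eq_div, le_div_iff₀ (hP a ha), mul_comm]
  exact Finset.single_le_sum (f := fun a => P a * Real.exp (∑ i, (a i : ℝ) * x i))
    (fun b hb => mul_nonneg (hP b hb).le (Real.exp_pos _).le) ha

lemma logIntegrand_eq_sum {n : ℕ} {A : Finset (Fin n → ℤ)} {P : (Fin n → ℤ) → ℝ}
    (hA : A.Nonempty) (hP : ∀ a ∈ A, 0 < P a) (α0 : ℂ) (α : Fin n → ℂ) (x : Fin n → ℝ) :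
    logIntegrand A P α0 α x =
      ∑ a ∈ A, (P a : ℂ) * logIntegrand A P (α0 + 1) (fun i => α i + (a i : ℂ)) x := by
  have hG := (expSum_pos hA hP x).ne'
  have hone : ∑ a ∈ A, P a * (Real.exp (∑ i, (a i : ℝ) * x i) / expSum A P x) = 1 := by
    simp only [← mul_div_assoc, ← Finset.sum_div]
    exact div_self hG
  simp only [logIntegrand_add hA hP, ← mul_assoc, ← Finset.sum_mul, ← Complex.ofReal_mul,
    ← Complex.ofReal_sum, hone]
  simp

lemma hasLineDerivAt_logIntegrand {n : ℕ} {A : Finset (Fin n → ℤ)} {P : (Fin n → ℤ) → ℝ}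
    (hA : A.Nonempty) (hP : ∀ a ∈ A, 0 < P a) (α0 : ℂ) (α : Fin n → ℂ) (x v : Fin n → ℝ) :
    HasLineDerivAt ℝ (logIntegrand A P α0 α)
      ((∑ i, (v i : ℂ) * α i) * logIntegrand A P α0 α x -
        α0 * ∑ a ∈ A, (∑ i, (v i : ℂ) * (a i : ℂ)) * (P a : ℂ) *
          logIntegrand A P (α0 + 1) (fun i => α i + (a i : ℂ)) x) x v := by
  have hG := (expSum_pos hA hP x).ne'
  have hcoord (i : Fin n) : HasDerivAt (fun s : ℝ => (x + s • v) i) (v i) 0 := by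
    simpa using ((hasDerivAt_id (0 : ℝ)).mul_const (v i)).const_add (x i)
  have hsum : HasDerivAt (fun s : ℝ => expSum A P (x + s • v))
      (∑ a ∈ A, P a * (Real.exp (∑ i, (a i : ℝ) * x i) * ∑ i, (a i : ℝ) * v i)) 0 := by
    unfold expSum
    refine HasDerivAt.fun_sum fun a _ => HasDerivAt.const_mul _ ?_
    simpa using (HasDerivAt.fun_sum fun i (_ : i ∈ Finset.univ) =>
      (hcoord i).const_mul (a i : ℝ)).exp
  have hlog := (hsum.log (by simpa using hG)).ofReal_comp
  have hlin : HasDerivAt (fun s : ℝ => ∑ i, α i * (((x + s • v) i : ℝ) : ℂ))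
      (∑ i, α i * (v i : ℂ)) 0 :=
    HasDerivAt.fun_sum fun i _ => (hcoord i).ofReal_comp.const_mul (α i)
  have h := (hlin.sub (hlog.const_mul α0)).cexp
  unfold HasLineDerivAt
  refine h.congr_deriv ?_
  simp only [logIntegrand_add hA hP, ← mul_assoc, ← Finset.sum_mul]
  simp only [zero_smul, add_zero, Pi.sub_apply]
  rw [← logIntegrand.eq_1 A P α0 α x, ← sub_mul, mul_comm]
  congr 2
  · simp only [mul_comm]
  · push_cast
    rw [Finset.sum_div]
    congr 1
    refine Finset.sum_congr rfl fun a _ => ?_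
    simp only [mul_comm (a _ : ℂ)]
    ring

lemma integral_eq_zero_of_hasLineDerivAt {E F : Type*} [NormedAddCommGroup E] [NormedSpace ℝ E]
    [FiniteDimensional ℝ E] [MeasurableSpace E] [BorelSpace E] {μ : Measure E}
    [μ.IsAddHaarMeasure] [NormedAddCommGroup F] [NormedSpace ℝ F] {f f' : E → F} {v : E}
    (hf : Integrable f μ) (hf' : Integrable f' μ) (h : ∀ x, HasLineDerivAt ℝ f (f' x) x v) :
    ∫ x, f' x ∂μ = 0 := by
  have hconst (x : E) : HasLineDerivAt ℝ (fun _ : E => (1 : ℝ)) 0 x v :=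
    hasDerivAt_const _ _
  simpa using integral_bilinear_hasLineDerivAt_right_eq_neg_left_of_integrable (μ := μ)
    (f := fun _ : E => (1 : ℝ)) (f' := fun _ => 0) (g := f) (g' := f') (v := v)
    (B := ContinuousLinearMap.lsmul ℝ ℝ) (by simp) (by simpa using hf') (by simpa using hf)
    (fun x _ => hconst x) (fun x _ => h x)

/-- Contiguity relation: for any `w ∈ ℤ^{n+1}`,
`⟨w, α⟩ K(α) = α₀ Σ_{a∈A} ⟨w, a⟩ P_a K(α + a)`. -/
theorem toric_contiguity (n : ℕ) (A : Finset (Fin n → ℤ))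
    (P : (Fin n → ℤ) → ℝ) (hP : ∀ a ∈ A, 0 < P a)
    (α0 : ℂ) (α : Fin n → ℂ)
    (hα : ((α0.re, fun i => (α i).re) : ℝ × (Fin n → ℝ)) ∈ interior (coneA n A))
    (w0 : ℤ) (w : Fin n → ℤ) :
    ((w0 : ℂ) * α0 + ∑ i, (w i : ℂ) * α i) * Kint n A P α0 α =
      α0 * ∑ a ∈ A, ((w0 : ℂ) + ∑ i, (w i : ℂ) * (a i : ℂ)) * (P a : ℂ) *
        Kint n A P (α0 + 1) (fun i => α i + (a i : ℂ)) := by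
  have hA := nonempty_of_mem_interior_coneA hα
  have hF := integrable_logIntegrand hP hα
  have hFa (a) (ha : a ∈ A) := integrable_logIntegrand_add hP hα ha
  simp only [Kint_eq_integral_logIntegrand hA hP]
  have hscale : ∫ x, logIntegrand A P α0 α x = ∑ a ∈ A, (P a : ℂ) *
      ∫ x, logIntegrand A P (α0 + 1) (fun i => α i + (a i : ℂ)) x := by
    rw [funext (logIntegrand_eq_sum hA hP α0 α),
      integral_finsetSum _ fun a ha => (hFa a ha).const_mul _]
    simp only [integral_const_mul]
  have hFsum : Integrable fun x => ∑ a ∈ A, (∑ i, (w i : ℂ) * (a i : ℂ)) * (P a : ℂ) *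
      logIntegrand A P (α0 + 1) (fun i => α i + (a i : ℂ)) x :=
    integrable_finsetSum _ fun a ha => (hFa a ha).const_mul _
  have hparts := integral_eq_zero_of_hasLineDerivAt (v := fun i => (w i : ℝ)) hF
    (by simpa [Pi.sub_def] using (hF.const_mul _).sub (hFsum.const_mul α0))
    (hasLineDerivAt_logIntegrand hA hP α0 α · _)
  simp only [Complex.ofReal_intCast] at hparts
  rw [integral_sub (hF.const_mul _) (hFsum.const_mul α0), integral_const_mul, integral_const_mul,
    integral_finsetSum _ fun a ha => (hFa a ha).const_mul _, sub_eq_zero] at hparts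
  simp only [integral_const_mul] at hparts
  rw [add_mul, hparts, hscale, mul_right_comm, mul_comm _ α0, ← mul_add,
    Finset.mul_sum, ← Finset.sum_add_distrib]
  congr 1
  refine Finset.sum_congr rfl fun a _ => ?_
  ring
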